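/- If α < λ₁(V), then for every real number β the functional J_{α,β}(u) = (1/2)∫_V (|∇u|² − α u²) dμ − β log ∫_V h e^u dμ attains its infimum over H at some u ∈ H, and this minimizer u satisfies the Kazdan–Warner equation Δu + αu = −β h e^u / (∫_V h e^u dμ) + β / Vol(V) on V. -/

import Mathlib

open Finset

variable {V : Type*}

/-- Integral of `g` over `V` with respect to the measure `μ`. -/
noncomputable def intV [Fintype V] (μ g : V → ℝ) : ℝ := ∑ x, μ x * g x

/-- Volume of `V` with respect to the measure `μ`. -/
noncomputable def volV [Fintype V] (μ : V → ℝ) : ℝ := ∑ x, μ x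

/-- The space `H` of functions with zero mean. -/
def Hsp [Fintype V] (μ : V → ℝ) : Set (V → ℝ) := {u | intV μ u = 0}

/-- `|∇u|²(x)`, the squared length of the gradient of `u` at `x`. -/
noncomputable def gradSq [Fintype V] (G : SimpleGraph V) [DecidableRel G.Adj]
    (w : V → V → ℝ) (μ : V → ℝ) (u : V → ℝ) (x : V) : ℝ :=
  (1 / (2 * μ x)) * ∑ y, if G.Adj x y then w x y * (u y - u x) ^ 2 else 0

/-- The `μ`-Laplacian `Δu(x)`. -/
noncomputable def lapV [Fintype V] (G : SimpleGraph V) [DecidableRel G.Adj]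
    (w : V → V → ℝ) (μ : V → ℝ) (u : V → ℝ) (x : V) : ℝ :=
  (1 / μ x) * ∑ y, if G.Adj x y then w x y * (u y - u x) else 0

/-- The functional `J_β`. -/
noncomputable def Jb [Fintype V] (G : SimpleGraph V) [DecidableRel G.Adj]
    (w : V → V → ℝ) (μ h : V → ℝ) (β : ℝ) (u : V → ℝ) : ℝ :=
  (1 / 2) * intV μ (gradSq G w μ u)
    - β * Real.log (intV μ (fun x => h x * Real.exp (u x)))

/-- The functional `J_{α,β}`. -/
noncomputable def Jab [Fintype V] (G : SimpleGraph V) [DecidableRel G.Adj]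
    (w : V → V → ℝ) (μ h : V → ℝ) (α β : ℝ) (u : V → ℝ) : ℝ :=
  (1 / 2) * intV μ (fun x => gradSq G w μ u x - α * u x ^ 2)
    - β * Real.log (intV μ (fun x => h x * Real.exp (u x)))

/-- The first non-zero eigenvalue `λ₁(V)` of `-Δ`, defined variationally. -/
noncomputable def lam1V [Fintype V] (G : SimpleGraph V) [DecidableRel G.Adj]
    (w : V → V → ℝ) (μ : V → ℝ) : ℝ :=
  sInf ((fun u => intV μ (gradSq G w μ u)) ''
    {u | u ∈ Hsp μ ∧ intV μ (fun x => u x ^ 2) = 1})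

/-- The eigenspace of `-Δ` with eigenvalue `c` (inside `H`). -/
def eigSp [Fintype V] (G : SimpleGraph V) [DecidableRel G.Adj]
    (w : V → V → ℝ) (μ : V → ℝ) (c : ℝ) : Set (V → ℝ) :=
  {v | intV μ v = 0 ∧ ∀ x, -(lapV G w μ v x) = c * v x}

/-- `E_k^⊥`: functions in `H` orthogonal to the eigenspaces of the first `k`
distinct non-zero eigenvalues (`lam` lists the distinct non-zero eigenvalues,
0-indexed, so `lam ⟨s⟩` is `λ_{s+1}(V)`). -/
def EkPerp [Fintype V] (G : SimpleGraph V) [DecidableRel G.Adj]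
    (w : V → V → ℝ) (μ : V → ℝ) {m : ℕ} (lam : Fin m → ℝ) (k : ℕ) : Set (V → ℝ) :=
  {u | u ∈ Hsp μ ∧ ∀ s : Fin m, (s : ℕ) < k → ∀ v ∈ eigSp G w μ (lam s),
    intV μ (fun x => u x * v x) = 0}

/-- The Dirichlet form `∫ ⟨∇u, ∇v⟩ dμ`, which does not depend on `μ`. -/
noncomputable def dirichletForm [Fintype V] (G : SimpleGraph V) [DecidableRel G.Adj]
    (w : V → V → ℝ) (u v : V → ℝ) : ℝ :=
  (1 / 2) * ∑ x, ∑ y, if G.Adj x y then w x y * ((u y - u x) * (v y - v x)) else 0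

lemma intV_gradSq [Fintype V] (G : SimpleGraph V) [DecidableRel G.Adj] (w : V → V → ℝ)
    {μ : V → ℝ} (hμ : ∀ x, 0 < μ x) (u : V → ℝ) :
    intV μ (gradSq G w μ u) = dirichletForm G w u u := by
  unfold intV gradSq dirichletForm
  rw [mul_sum]
  refine sum_congr rfl fun x _ => ?_
  have := (hμ x).ne'
  simp only [← sq]
  field_simp

lemma intV_mul_lapV [Fintype V] (G : SimpleGraph V) [DecidableRel G.Adj] {w : V → V → ℝ}
    (hws : ∀ x y, w x y = w y x) {μ : V → ℝ} (hμ : ∀ x, 0 < μ x) (u v : V → ℝ) :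
    intV μ (fun x => lapV G w μ u x * v x) = -dirichletForm G w u v := by
  have hleft : intV μ (fun x => lapV G w μ u x * v x)
      = ∑ x, ∑ y, if G.Adj x y then w x y * (u y - u x) * v x else 0 := by
    unfold intV lapV
    refine sum_congr rfl fun x _ => ?_
    have := (hμ x).ne'
    field_simp
    rw [sum_mul]
    refine sum_congr rfl fun y _ => ?_
    split_ifs <;> ring
  have hswap : ∑ x, ∑ y, (if G.Adj x y then w x y * (u y - u x) * v x else 0)
      = ∑ x, ∑ y, if G.Adj x y then w x y * (u x - u y) * v y else 0 := by
    rw [sum_comm]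
    refine sum_congr rfl fun x _ => sum_congr rfl fun y _ => ?_
    simp only [G.adj_comm y x, hws y x]
  have hsum : ∑ x, ∑ y, (if G.Adj x y then w x y * ((u y - u x) * (v y - v x)) else 0)
      = -∑ x, ∑ y, (if G.Adj x y then w x y * (u y - u x) * v x else 0)
        - ∑ x, ∑ y, if G.Adj x y then w x y * (u x - u y) * v y else 0 := by
    simp only [← sum_neg_distrib, ← sum_sub_distrib]
    refine sum_congr rfl fun x _ => sum_congr rfl fun y _ => ?_
    split_ifs <;> ring
  rw [hleft, dirichletForm, hsum, ← hswap]
  ring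

lemma intV_lapV [Fintype V] (G : SimpleGraph V) [DecidableRel G.Adj] {w : V → V → ℝ}
    (hws : ∀ x y, w x y = w y x) {μ : V → ℝ} (hμ : ∀ x, 0 < μ x) (u : V → ℝ) :
    intV μ (lapV G w μ u) = 0 := by
  have := intV_mul_lapV G hws hμ u (fun _ => 1)
  simpa [dirichletForm] using this

lemma dirichletForm_nonneg [Fintype V] (G : SimpleGraph V) [DecidableRel G.Adj]
    {w : V → V → ℝ} (hwp : ∀ x y, G.Adj x y → 0 < w x y) (u : V → ℝ) :
    0 ≤ dirichletForm G w u u := by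
  refine mul_nonneg (by norm_num) (sum_nonneg fun x _ => sum_nonneg fun y _ => ?_)
  split_ifs with hxy
  · exact mul_nonneg (hwp x y hxy).le (mul_self_nonneg _)
  · exact le_rfl

lemma dirichletForm_smul_smul [Fintype V] (G : SimpleGraph V) [DecidableRel G.Adj]
    (w : V → V → ℝ) (c : ℝ) (u : V → ℝ) :
    dirichletForm G w (c • u) (c • u) = c ^ 2 * dirichletForm G w u u := by
  simp only [dirichletForm, mul_left_comm (c ^ 2), mul_sum, Pi.smul_apply, smul_eq_mul]
  refine sum_congr rfl fun x _ => sum_congr rfl fun y _ => ?_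
  split_ifs <;> ring

lemma dirichletForm_add_smul [Fintype V] (G : SimpleGraph V) [DecidableRel G.Adj]
    (w : V → V → ℝ) (u v : V → ℝ) (t : ℝ) :
    dirichletForm G w (u + t • v) (u + t • v)
      = dirichletForm G w u u + 2 * t * dirichletForm G w u v
        + t ^ 2 * dirichletForm G w v v := by
  simp only [dirichletForm, mul_sum, ← sum_add_distrib, Pi.add_apply, Pi.smul_apply, smul_eq_mul]
  refine sum_congr rfl fun x _ => sum_congr rfl fun y _ => ?_
  split_ifs <;> ring

lemma lam1V_mul_intV_sq_le [Fintype V] (G : SimpleGraph V) [DecidableRel G.Adj]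
    {w : V → V → ℝ} (hwp : ∀ x y, G.Adj x y → 0 < w x y) {μ : V → ℝ} (hμ : ∀ x, 0 < μ x)
    {u : V → ℝ} (hu : u ∈ Hsp μ) :
    lam1V G w μ * intV μ (fun x => u x ^ 2) ≤ dirichletForm G w u u := by
  have hnn : 0 ≤ intV μ (fun x => u x ^ 2) :=
    sum_nonneg fun x _ => mul_nonneg (hμ x).le (sq_nonneg _)
  rcases hnn.eq_or_lt with h0 | hpos
  · rw [← h0, mul_zero]
    exact dirichletForm_nonneg G hwp u
  set N := intV μ (fun x => u x ^ 2)
  have hc : (√N)⁻¹ ^ 2 = N⁻¹ := by rw [inv_pow, Real.sq_sqrt hpos.le]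
  have hmem : (√N)⁻¹ • u ∈ {u | u ∈ Hsp μ ∧ intV μ (fun x => u x ^ 2) = 1} := by
    constructor
    · have : ∑ x, μ x * u x = 0 := hu
      change ∑ x, μ x * ((√N)⁻¹ * u x) = 0
      simp only [mul_left_comm (μ _), ← mul_sum, this, mul_zero]
    · change ∑ x, μ x * ((√N)⁻¹ * u x) ^ 2 = 1
      simp only [mul_pow, hc, mul_left_comm (μ _), ← mul_sum]
      exact inv_mul_cancel₀ hpos.ne'
  have hbdd : BddBelow ((fun u => intV μ (gradSq G w μ u)) ''
      {u | u ∈ Hsp μ ∧ intV μ (fun x => u x ^ 2) = 1}) := by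
    refine ⟨0, ?_⟩
    rintro _ ⟨v, -, rfl⟩
    simpa only [intV_gradSq G w hμ] using dirichletForm_nonneg G hwp v
  have hle := csInf_le hbdd (Set.mem_image_of_mem _ hmem)
  simp only [intV_gradSq G w hμ, dirichletForm_smul_smul, hc] at hle
  rw [← le_div_iff₀ hpos, div_eq_inv_mul]
  simpa only [lam1V, intV_gradSq G w hμ] using hle

lemma Jab_eq [Fintype V] (G : SimpleGraph V) [DecidableRel G.Adj] (w : V → V → ℝ)
    {μ : V → ℝ} (hμ : ∀ x, 0 < μ x) (h : V → ℝ) (α β : ℝ) (u : V → ℝ) :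
    Jab G w μ h α β u = (1 / 2) * (dirichletForm G w u u - α * intV μ (fun x => u x ^ 2))
      - β * Real.log (intV μ (fun x => h x * Real.exp (u x))) := by
  rw [← intV_gradSq G w hμ]
  simp only [Jab, intV, mul_sum, ← sum_sub_distrib]
  congr 1
  exact sum_congr rfl fun x _ => by ring

lemma intV_pos [Fintype V] [Nonempty V] {μ g : V → ℝ} (hμ : ∀ x, 0 < μ x)
    (hg : ∀ x, 0 < g x) : 0 < intV μ g :=
  sum_pos (fun x _ => mul_pos (hμ x) (hg x)) univ_nonempty

lemma continuous_Jab [Fintype V] [Nonempty V] (G : SimpleGraph V) [DecidableRel G.Adj]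
    (w : V → V → ℝ) {μ h : V → ℝ} (hμ : ∀ x, 0 < μ x) (hh : ∀ x, 0 < h x) (α β : ℝ) :
    Continuous (Jab G w μ h α β) := by
  have hlog : Continuous fun u : V → ℝ =>
      Real.log (intV μ (fun x => h x * Real.exp (u x))) := by
    refine Continuous.log ?_ fun u =>
      (intV_pos hμ fun x => mul_pos (hh x) (Real.exp_pos _)).ne'
    unfold intV
    fun_prop
  have hgrad : ∀ x, Continuous fun u : V → ℝ => gradSq G w μ u x := by
    intro x
    unfold gradSq
    refine continuous_const.mul (continuous_finsetSum _ fun y _ => ?_)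
    split_ifs <;> fun_prop
  unfold Jab
  refine Continuous.sub (continuous_const.mul ?_) (continuous_const.mul hlog)
  unfold intV
  fun_prop

lemma abs_log_intV_exp_le [Fintype V] [Nonempty V] {μ h : V → ℝ} (hμ : ∀ x, 0 < μ x)
    (hh : ∀ x, 0 < h x) (u : V → ℝ) :
    |Real.log (intV μ (fun x => h x * Real.exp (u x)))| ≤ |Real.log (intV μ h)| + ‖u‖ := by
  have hu : ∀ x, |u x| ≤ ‖u‖ := fun x => norm_le_pi_norm u x
  have hI := intV_pos hμ hh
  have hIe : 0 < intV μ (fun x => h x * Real.exp (u x)) :=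
    intV_pos hμ fun x => mul_pos (hh x) (Real.exp_pos _)
  have hupper : intV μ (fun x => h x * Real.exp (u x)) ≤ intV μ h * Real.exp ‖u‖ := by
    simp only [intV, sum_mul, mul_assoc]
    refine sum_le_sum fun x _ => mul_le_mul_of_nonneg_left
      (mul_le_mul_of_nonneg_left ?_ (hh x).le) (hμ x).le
    exact Real.exp_le_exp.2 (abs_le.1 (hu x)).2
  have hlower : intV μ h * Real.exp (-‖u‖) ≤ intV μ (fun x => h x * Real.exp (u x)) := by
    simp only [intV, sum_mul, mul_assoc]
    refine sum_le_sum fun x _ => mul_le_mul_of_nonneg_left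
      (mul_le_mul_of_nonneg_left ?_ (hh x).le) (hμ x).le
    exact Real.exp_le_exp.2 (abs_le.1 (hu x)).1
  have h1 := Real.log_le_log hIe hupper
  have h2 := Real.log_le_log (mul_pos hI (Real.exp_pos _)) hlower
  rw [Real.log_mul hI.ne' (Real.exp_pos _).ne', Real.log_exp] at h1 h2
  rw [abs_le]
  constructor <;> linarith [neg_abs_le (Real.log (intV μ h)), le_abs_self (Real.log (intV μ h))]

lemma exists_pos_mul_norm_sq_le_intV_sq [Fintype V] [Nonempty V] {μ : V → ℝ}
    (hμ : ∀ x, 0 < μ x) :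
    ∃ m > 0, ∀ u : V → ℝ, m * ‖u‖ ^ 2 ≤ intV μ (fun x => u x ^ 2) := by
  obtain ⟨x₀, hx₀⟩ := Finite.exists_min μ
  refine ⟨μ x₀, hμ x₀, fun u => ?_⟩
  obtain ⟨y, hy⟩ := Finite.exists_max fun x => ‖u x‖
  have hnorm : ‖u‖ ≤ ‖u y‖ := (pi_norm_le_iff_of_nonneg (norm_nonneg _)).2 hy
  calc μ x₀ * ‖u‖ ^ 2 ≤ μ y * ‖u y‖ ^ 2 := by
        have := hx₀ y
        have := hμ y
        gcongr
    _ = μ y * u y ^ 2 := by rw [Real.norm_eq_abs, sq_abs]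
    _ ≤ intV μ (fun x => u x ^ 2) :=
        single_le_sum (f := fun x => μ x * u x ^ 2)
          (fun x _ => mul_nonneg (hμ x).le (sq_nonneg _)) (mem_univ y)

lemma exists_forall_le_Jab [Fintype V] [Nonempty V] (G : SimpleGraph V) [DecidableRel G.Adj]
    {w : V → V → ℝ} (hwp : ∀ x y, G.Adj x y → 0 < w x y) {μ h : V → ℝ} (hμ : ∀ x, 0 < μ x)
    (hh : ∀ x, 0 < h x) {α : ℝ} (β : ℝ) (hα : α < lam1V G w μ) :
    ∃ u ∈ Hsp μ, ∀ v ∈ Hsp μ, Jab G w μ h α β u ≤ Jab G w μ h α β v := by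
  obtain ⟨m, hm, hmu⟩ := exists_pos_mul_norm_sq_le_intV_sq hμ
  have hclosed : IsClosed (Hsp μ) := by
    refine isClosed_eq ?_ continuous_const
    unfold intV
    fun_prop
  have hzero : (0 : V → ℝ) ∈ Hsp μ := by simp [Hsp, intV]
  set a := (lam1V G w μ - α) * m / 2 with ha
  have hapos : 0 < a := by have := sub_pos.2 hα; positivity
  set L := |Real.log (intV μ h)|
  set d := |β| * L + |Jab G w μ h α β 0|
  have hcoercive : ∀ u ∈ Hsp μ, a * ‖u‖ ^ 2 - |β| * (L + ‖u‖) ≤ Jab G w μ h α β u := by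
    intro u hu
    rw [Jab_eq G w hμ]
    have h1 := lam1V_mul_intV_sq_le G hwp hμ hu
    have h2 := mul_le_mul_of_nonneg_left (hmu u) (sub_pos.2 hα).le
    have h3 := mul_le_mul_of_nonneg_left (abs_log_intV_exp_le hμ hh u) (abs_nonneg β)
    rw [← abs_mul] at h3
    have h4 := (le_abs_self _).trans h3
    rw [ha]
    linarith
  obtain ⟨u, hu, hmin⟩ := (continuous_Jab G w hμ hh α β).continuousOn.exists_isMinOn'
    hclosed hzero (by
      rw [Filter.eventually_inf_principal]
      filter_upwards [(tendsto_norm_cocompact_atTop (E := V → ℝ)).eventually_ge_atTop 1,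
        (tendsto_norm_cocompact_atTop (E := V → ℝ)).eventually_ge_atTop ((|β| + d) / a)]
        with u h1 h2 hu
      refine le_trans ?_ (hcoercive u hu)
      have hd0 : 0 ≤ d := by positivity
      have h3 : |β| + d ≤ a * ‖u‖ := (div_le_iff₀' hapos).1 h2
      have h4 := mul_le_mul_of_nonneg_right h3 (norm_nonneg u)
      have h5 := mul_le_mul_of_nonneg_left h1 hd0
      have h6 := le_abs_self (Jab G w μ h α β 0)
      nlinarith)
  exact ⟨u, hu, fun v hv => hmin hv⟩

lemma hasDerivAt_Jab_add_smul [Fintype V] [Nonempty V] (G : SimpleGraph V)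
    [DecidableRel G.Adj] (w : V → V → ℝ) {μ h : V → ℝ} (hμ : ∀ x, 0 < μ x)
    (hh : ∀ x, 0 < h x) (α β : ℝ) (u v : V → ℝ) :
    HasDerivAt (fun t : ℝ => Jab G w μ h α β (u + t • v))
      (dirichletForm G w u v - α * intV μ (fun x => u x * v x)
        - β * (intV μ (fun x => h x * Real.exp (u x) * v x)
          / intV μ (fun x => h x * Real.exp (u x)))) 0 := by
  have hsq : ∀ t : ℝ, intV μ (fun x => (u + t • v) x ^ 2) = intV μ (fun x => u x ^ 2)
      + 2 * t * intV μ (fun x => u x * v x) + t ^ 2 * intV μ (fun x => v x ^ 2) := by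
    intro t
    simp only [intV, mul_sum, ← sum_add_distrib, Pi.add_apply, Pi.smul_apply, smul_eq_mul]
    exact sum_congr rfl fun x _ => by ring
  simp only [Jab_eq G w hμ, dirichletForm_add_smul, hsq]
  have hquad : ∀ A B C : ℝ, HasDerivAt (fun t : ℝ => A + 2 * t * B + t ^ 2 * C) (2 * B) 0 := by
    intro A B C
    have h1 : HasDerivAt (fun t : ℝ => 2 * t * B) (2 * 1 * B) 0 :=
      ((hasDerivAt_id 0).const_mul 2).mul_const B
    have h2 := ((hasDerivAt_pow 2 (0 : ℝ)).mul_const C)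
    exact ((h1.const_add A).fun_add h2).congr_deriv (by simp)
  have hexp : HasDerivAt (fun t : ℝ => intV μ (fun x => h x * Real.exp ((u + t • v) x)))
      (intV μ (fun x => h x * Real.exp (u x) * v x)) 0 := by
    unfold intV
    refine HasDerivAt.fun_sum fun x _ => HasDerivAt.const_mul _ ?_
    have h1 : HasDerivAt (fun t : ℝ => u x + t * v x) (v x) 0 := by
      simpa using ((hasDerivAt_id (0 : ℝ)).mul_const (v x)).const_add (u x)
    simpa [mul_assoc] using h1.exp.const_mul (h x)
  have hlog := (hexp.log
    (intV_pos hμ fun x => mul_pos (hh x) (Real.exp_pos _)).ne').const_mul β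
  simp only [zero_smul, add_zero] at hlog
  refine ((((hquad _ _ _).sub ((hquad _ _ _).const_mul α)).const_mul (1 / 2)).sub
    hlog).congr_deriv ?_
  ring

lemma kazdanWarner_of_forall_le_Jab [Fintype V] [Nonempty V] (G : SimpleGraph V)
    [DecidableRel G.Adj] {w : V → V → ℝ} (hws : ∀ x y, w x y = w y x) {μ h : V → ℝ}
    (hμ : ∀ x, 0 < μ x) (hh : ∀ x, 0 < h x) (α β : ℝ) {u : V → ℝ} (hu : u ∈ Hsp μ)
    (hmin : ∀ v ∈ Hsp μ, Jab G w μ h α β u ≤ Jab G w μ h α β v) (x : V) :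
    lapV G w μ u x + α * u x =
      -(β * h x * Real.exp (u x)) / intV μ (fun y => h y * Real.exp (u y))
        + β / volV μ := by
  set I := intV μ (fun y => h y * Real.exp (u y)) with hI
  have hIpos : 0 < I := intV_pos hμ fun x => mul_pos (hh x) (Real.exp_pos _)
  have hvol : 0 < volV μ := sum_pos (fun x _ => hμ x) univ_nonempty
  set φ : V → ℝ := fun x =>
    lapV G w μ u x + α * u x + β / I * (h x * Real.exp (u x)) - β / volV μ with hφ
  have hφH : intV μ φ = 0 := by
    have h1 : intV μ φ = intV μ (lapV G w μ u) + α * intV μ u + β / I * I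
        - β / volV μ * volV μ := by
      simp only [hI, intV, volV, mul_sum, ← sum_add_distrib, ← sum_sub_distrib]
      refine sum_congr rfl fun x _ => ?_
      simp only [hφ, hI, intV, volV]
      ring
    have h2 : intV μ u = 0 := hu
    rw [h1, intV_lapV G hws hμ, h2, div_mul_cancel₀ _ hIpos.ne', div_mul_cancel₀ _ hvol.ne']
    ring
  have hline : ∀ t : ℝ, u + t • φ ∈ Hsp μ := by
    intro t
    have h1 : intV μ (u + t • φ) = intV μ u + t * intV μ φ := by
      simp only [intV, mul_sum, ← sum_add_distrib, Pi.add_apply, Pi.smul_apply, smul_eq_mul]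
      exact sum_congr rfl fun x _ => by ring
    have h2 : intV μ u = 0 := hu
    change intV μ (u + t • φ) = 0
    rw [h1, h2, hφH, mul_zero, add_zero]
  have hcrit := IsLocalMin.hasDerivAt_eq_zero
    (Filter.Eventually.of_forall fun t => by simpa using hmin _ (hline t))
    (hasDerivAt_Jab_add_smul G w hμ hh α β u φ)
  have hsq : intV μ (fun x => φ x ^ 2) = 0 := by
    have h1 : intV μ (fun x => φ x ^ 2) = intV μ (fun x => lapV G w μ u x * φ x)
        + α * intV μ (fun x => u x * φ x)
        + β / I * intV μ (fun x => h x * Real.exp (u x) * φ x) - β / volV μ * intV μ φ := by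
      simp only [intV, mul_sum, ← sum_add_distrib, ← sum_sub_distrib]
      refine sum_congr rfl fun x _ => ?_
      have h2 : φ x = lapV G w μ u x + α * u x + β / I * (h x * Real.exp (u x)) - β / volV μ :=
        rfl
      linear_combination μ x * φ x * h2
    rw [h1, hφH, intV_mul_lapV G hws hμ]
    linear_combination -hcrit
  have hx := (sum_eq_zero_iff_of_nonneg
    fun x _ => mul_nonneg (hμ x).le (sq_nonneg (φ x))).1 hsq x (mem_univ x)
  have hφx : φ x = 0 := by simpa [(hμ x).ne'] using hx
  linear_combination hφx

theorem stmt1 [Fintype V] [Nontrivial V] (G : SimpleGraph V) [DecidableRel G.Adj]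
    (hG : G.Connected) (w : V → V → ℝ) (hws : ∀ x y, w x y = w y x)
    (hwp : ∀ x y, G.Adj x y → 0 < w x y)
    (μ : V → ℝ) (hμ : ∀ x, 0 < μ x) (h : V → ℝ) (hh : ∀ x, 0 < h x) (α β : ℝ) (hα : α < lam1V G w μ) :
    ∃ u ∈ Hsp μ, (∀ v ∈ Hsp μ, Jab G w μ h α β u ≤ Jab G w μ h α β v) ∧
      ∀ x, lapV G w μ u x + α * u x =
        -(β * h x * Real.exp (u x)) / intV μ (fun y => h y * Real.exp (u y))
          + β / volV μ := by
  obtain ⟨u, hu, hmin⟩ := exists_forall_le_Jab G hwp hμ hh β hα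
  exact ⟨u, hu, hmin, kazdanWarner_of_forall_le_Jab G hws hμ hh α β hu hmin⟩
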